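/- arXiv:1607.04361 — 3 statements merged into one kernel-verified Lean document; each statement's English description precedes it below -/
import Mathlib

section
/- Let κ ∈ (0,1/2) and let ω : (0,1] → [0,∞) satisfy ω(t) ≤ (ln(4/t))^{−2} for all 0 < t ≤ 1. Then there is a constant C, depending only on κ, such that ∫₀^r ω̃(t)/t dt ≤ C (ln(4/r))^{−1} for every r ∈ (0,1]. -/
open MeasureTheory Set

/-- `ω̃(t) = ∑_{i=1}^∞ 2^{-i} ω(min(κ^{-i} t, 1))`. -/
noncomputable def tildeOmega (κ : ℝ) (ω : ℝ → ℝ) (t : ℝ) : ℝ :=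
  ∑' i : ℕ, (1/2 : ℝ) ^ (i+1) * ω (min (t / κ ^ (i+1)) 1)

open Filter Topology in
/-- The function `t ↦ (log (4/t))⁻¹`, with value `0` at `0`, is continuous on `[0,1]`. -/
theorem continuousOn_inv_log_four_div :
    ContinuousOn (fun t : ℝ => (Real.log (4 / t))⁻¹) (Icc 0 1) := by
  intro t ht
  rcases ht.1.eq_or_lt with rfl | h0
  · have key : ContinuousWithinAt (fun t : ℝ => (Real.log (4 / t))⁻¹) (Ioi 0) 0 := by
      have h1 : Tendsto (fun t : ℝ => 4 / t) (𝓝[>] 0) atTop := by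
        simpa only [div_eq_mul_inv] using
          tendsto_inv_nhdsGT_zero.const_mul_atTop (by norm_num : (0 : ℝ) < 4)
      simpa [ContinuousWithinAt, Function.comp_def] using
        tendsto_inv_atTop_zero.comp (Real.tendsto_log_atTop.comp h1)
    exact (continuousWithinAt_Ioi_iff_Ici.1 key).mono Icc_subset_Ici_self
  · have h4 : 1 < 4 / t := by rw [lt_div_iff₀ h0]; linarith [ht.2]
    exact (((continuousAt_const.div continuousAt_id h0.ne').log (by simp; positivity)).inv₀
      (Real.log_pos h4).ne').continuousWithinAt

theorem hasDerivAt_inv_log_four_div {t : ℝ} (h0 : 0 < t) (h1 : t ≤ 1) :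
    HasDerivAt (fun t : ℝ => (Real.log (4 / t))⁻¹) (1 / Real.log (4 / t) ^ 2 / t) t := by
  have h4 : 1 < 4 / t := by rw [lt_div_iff₀ h0]; linarith
  have hl := (Real.log_pos h4).ne'
  have hd : HasDerivAt (fun t : ℝ => 4 / t) (-4 / t ^ 2) t := by
    refine ((hasDerivAt_const t (4 : ℝ)).fun_div (hasDerivAt_id' t) h0.ne').congr_deriv ?_
    ring
  refine ((hd.log (by positivity)).fun_inv hl).congr_deriv ?_
  field_simp

theorem lintegral_inv_sq_log_four_div {r : ℝ} (hr : r ∈ Ioc (0 : ℝ) 1) :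
    ∫⁻ t in Ioc (0 : ℝ) r, ENNReal.ofReal (1 / Real.log (4 / t) ^ 2 / t)
      = ENNReal.ofReal (Real.log (4 / r))⁻¹ := by
  have hc := continuousOn_inv_log_four_div.mono (Icc_subset_Icc_right hr.2)
  have hd : ∀ t ∈ Ioo 0 r, HasDerivAt (fun t : ℝ => (Real.log (4 / t))⁻¹)
      (1 / Real.log (4 / t) ^ 2 / t) t := fun t ht =>
    hasDerivAt_inv_log_four_div ht.1 (ht.2.le.trans hr.2)
  have hi := intervalIntegral.integrableOn_deriv_of_nonneg hc hd
    fun t ht => div_nonneg (by positivity) ht.1.le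
  rw [← ofReal_integral_eq_lintegral_ofReal hi, ← intervalIntegral.integral_of_le hr.1.le,
    intervalIntegral.integral_eq_sub_of_hasDerivAt_of_le hr.1.le hc hd
      ((intervalIntegrable_iff_integrableOn_Ioc_of_le hr.1.le).2 hi)]
  · simp
  · filter_upwards [ae_restrict_mem measurableSet_Ioc] with t ht
    exact div_nonneg (by positivity) ht.1.le

theorem summable_half_pow_mul_one_add_sq (l : ℝ) :
    Summable fun i : ℕ => (1 / 2 : ℝ) ^ (i + 1) * (1 + (i + 1 : ℕ) * l) ^ 2 := by
  refine (summable_nat_add_iff (f := fun n : ℕ => (1 / 2 : ℝ) ^ n * (1 + n * l) ^ 2) 1).2 ?_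
  have h (k : ℕ) := summable_pow_mul_geometric_of_norm_lt_one (R := ℝ) k
    (r := 1 / 2) (by norm_num)
  refine (((h 0).add ((h 1).mul_left (2 * l))).add ((h 2).mul_left (l ^ 2))).congr fun n => ?_
  ring

/-- Rescaling `t` by `κ⁻ⁿ` (truncated at `1`) changes `log (4/t)` by a factor at most
`1 + n log κ⁻¹`. -/
theorem log_four_div_le_mul {κ t : ℝ} (hκ : κ ∈ Ioo (0 : ℝ) 1) (ht : 0 < t) (n : ℕ) :
    Real.log (4 / t) ≤
      Real.log (4 / min (t / κ ^ n) 1) * (1 + n * Real.log κ⁻¹) := by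
  have hκn : 0 < κ ^ n := pow_pos hκ.1 n
  have hs : 0 < min (t / κ ^ n) 1 := lt_min (by positivity) one_pos
  have hl : 0 ≤ n * Real.log κ⁻¹ :=
    mul_nonneg n.cast_nonneg (Real.log_nonneg ((one_le_inv₀ hκ.1).2 hκ.2.le))
  have h1 : 1 ≤ Real.log (4 / min (t / κ ^ n) 1) := by
    rw [Real.le_log_iff_exp_le (by positivity), le_div_iff₀ hs]
    nlinarith [Real.exp_one_lt_d9, min_le_right (t / κ ^ n) 1]
  have h2 : Real.log (4 / t) - n * Real.log κ⁻¹ ≤ Real.log (4 / min (t / κ ^ n) 1) := by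
    calc _ = Real.log (4 / (t / κ ^ n)) := by
            rw [Real.log_div four_ne_zero ht.ne', Real.log_div four_ne_zero (by positivity),
              Real.log_div ht.ne' hκn.ne', Real.log_pow, Real.log_inv]
            ring
      _ ≤ _ := Real.log_le_log (by positivity)
            (div_le_div_of_nonneg_left (by norm_num) hs (min_le_left _ _))
  nlinarith

theorem tildeOmega_le_tsum_mul {κ t : ℝ} {ω : ℝ → ℝ} (hκ : κ ∈ Ioo (0 : ℝ) 1)
    (h0 : ∀ t ∈ Ioc (0 : ℝ) 1, 0 ≤ ω t)
    (hω : ∀ t ∈ Ioc (0 : ℝ) 1, ω t ≤ 1 / Real.log (4 / t) ^ 2) (ht : t ∈ Ioc (0 : ℝ) 1) :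
    tildeOmega κ ω t ≤
      (∑' i : ℕ, (1 / 2 : ℝ) ^ (i + 1) * (1 + (i + 1 : ℕ) * Real.log κ⁻¹) ^ 2) *
        (1 / Real.log (4 / t) ^ 2) := by
  have hS := (summable_half_pow_mul_one_add_sq (Real.log κ⁻¹)).mul_right
    (1 / Real.log (4 / t) ^ 2)
  have hmem (i : ℕ) : min (t / κ ^ (i + 1)) 1 ∈ Ioc (0 : ℝ) 1 :=
    ⟨lt_min (div_pos ht.1 (pow_pos hκ.1 _)) one_pos, min_le_right _ _⟩
  have hlog {s : ℝ} (hs : s ∈ Ioc (0 : ℝ) 1) : 0 < Real.log (4 / s) :=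
    Real.log_pos (by rw [lt_div_iff₀ hs.1]; linarith [hs.2])
  have hle (i : ℕ) : (1 / 2 : ℝ) ^ (i + 1) * ω (min (t / κ ^ (i + 1)) 1) ≤
      (1 / 2 : ℝ) ^ (i + 1) * (1 + (i + 1 : ℕ) * Real.log κ⁻¹) ^ 2 *
        (1 / Real.log (4 / t) ^ 2) := by
    rw [mul_assoc]
    refine mul_le_mul_of_nonneg_left ((hω _ (hmem i)).trans ?_) (by positivity)
    have hx := hlog (hmem i)
    have hL := hlog ht
    rw [mul_one_div, div_le_div_iff₀ (by positivity) (by positivity), one_mul, ← mul_pow,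
      mul_comm (1 + _)]
    exact pow_le_pow_left₀ hL.le (log_four_div_le_mul hκ ht.1 (i + 1)) 2
  rw [tildeOmega, ← tsum_mul_right]
  exact (Summable.of_nonneg_of_le (fun i => mul_nonneg (by positivity) (h0 _ (hmem i)))
    hle hS).tsum_le_tsum hle hS

/-- If `ω(t) ≤ (ln(4/t))⁻²` on `(0,1]`, then `∫₀^r ω̃(t)/t dt ≤ C (ln(4/r))⁻¹` for all
`r ∈ (0,1]`, with `C` depending only on `κ`. -/
theorem tildeOmega_integral_le_inv_log
    (κ : ℝ) (hκ : κ ∈ Set.Ioo (0:ℝ) (1/2)) :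
    ∃ C : ℝ, 0 < C ∧
      ∀ ω : ℝ → ℝ,
        (∀ t ∈ Set.Ioc (0:ℝ) 1, 0 ≤ ω t) →
        (∀ t ∈ Set.Ioc (0:ℝ) 1, ω t ≤ 1 / (Real.log (4/t)) ^ 2) →
        ∀ r ∈ Set.Ioc (0:ℝ) 1,
          ∫⁻ t in Set.Ioc (0:ℝ) r, ENNReal.ofReal (tildeOmega κ ω t / t)
            ≤ ENNReal.ofReal (C / Real.log (4/r)) := by
  have hκ' : κ ∈ Ioo (0 : ℝ) 1 := ⟨hκ.1, hκ.2.trans (by norm_num)⟩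
  have hl : 0 < Real.log κ⁻¹ := Real.log_pos ((one_lt_inv₀ hκ.1).2 hκ'.2)
  have hC : 0 < ∑' i : ℕ, (1 / 2 : ℝ) ^ (i + 1) * (1 + (i + 1 : ℕ) * Real.log κ⁻¹) ^ 2 :=
    (summable_half_pow_mul_one_add_sq _).tsum_pos (fun i => by positivity) 0 (by positivity)
  refine ⟨_, hC, fun ω h0 hω r hr => ?_⟩
  rw [div_eq_mul_inv, ENNReal.ofReal_mul hC.le, ← lintegral_inv_sq_log_four_div hr,
    ← lintegral_const_mul' _ _ ENNReal.ofReal_ne_top]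
  refine setLIntegral_mono' measurableSet_Ioc fun t ht => ?_
  rw [← ENNReal.ofReal_mul hC.le, ← mul_div_assoc]
  exact ENNReal.ofReal_le_ofReal (div_le_div_of_nonneg_right
    (tildeOmega_le_tsum_mul hκ' h0 hω ⟨ht.1, ht.2.trans hr.2⟩) ht.1.le)
end

section
/- Let κ ∈ (0,1/2) and let ω : (0,1] → [0,∞) be bounded with ∫₀¹ ω(t)/t dt < ∞. Then ω̃ also satisfies the Dini condition: ∫₀¹ ω̃(t)/t dt < ∞. -/
open MeasureTheory Set

/-- Rescaling by `κ` shows that passing from `κ⁻ⁿ` to `κ⁻ⁿ⁻¹` in the dilation of `ω` increases the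
Dini integral by at most a constant. -/
lemma lintegral_dilate_succ_le {κ : ℝ} (hκ : κ ∈ Ioo (0 : ℝ) 1) {ω : ℝ → ℝ} {M : ℝ} (hM : 0 ≤ M)
    (hωbd : ∀ t ∈ Ioc (0 : ℝ) 1, ω t ≤ M) (n : ℕ) :
    ∫⁻ t in Ioc (0 : ℝ) 1, ENNReal.ofReal (ω (min (t / κ ^ (n + 1)) 1) / t) ≤
      (∫⁻ t in Ioc (0 : ℝ) 1, ENNReal.ofReal (ω (min (t / κ ^ n) 1) / t)) +
        ENNReal.ofReal (M / κ) := by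
  obtain ⟨h0, h1⟩ := hκ
  rw [← Ioc_union_Ioc_eq_Ioc h0.le h1.le]
  refine (lintegral_union_le _ _ _).trans (add_le_add (le_of_eq ?_) ?_)
  · rw [Ioc_union_Ioc_eq_Ioc h0.le h1.le]
    have himg : (fun t : ℝ => κ * t) '' Ioc 0 1 = Ioc 0 κ := by
      rw [Set.image_mul_left_Ioc h0]; simp
    rw [← himg, lintegral_image_eq_lintegral_abs_deriv_mul measurableSet_Ioc
      (f' := fun _ => κ) (fun x _ => by simpa using
        ((hasDerivAt_id x).const_mul κ).hasDerivWithinAt)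
      (mul_right_injective₀ h0.ne').injOn]
    refine setLIntegral_congr_fun measurableSet_Ioc fun t ht => ?_
    have ht0 : t ≠ 0 := ht.1.ne'
    have hκ0 : κ ≠ 0 := h0.ne'
    have harg : κ * t / κ ^ (n + 1) = t / κ ^ n := by
      rw [pow_succ', mul_div_mul_left _ _ hκ0]
    simp only [harg]
    rw [← ENNReal.ofReal_mul (abs_nonneg _), abs_of_pos h0]
    congr 1
    field_simp
  · calc ∫⁻ t in Ioc κ 1, ENNReal.ofReal (ω (min (t / κ ^ (n + 1)) 1) / t)
        ≤ ∫⁻ _ in Ioc κ 1, ENNReal.ofReal (M / κ) := by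
          refine setLIntegral_mono' measurableSet_Ioc fun t ht => ENNReal.ofReal_le_ofReal ?_
          have ht0 : 0 < t := h0.trans ht.1
          exact div_le_div₀ hM (hωbd _ ⟨lt_min (by positivity) one_pos, min_le_right _ _⟩)
            h0 ht.1.le
      _ ≤ ENNReal.ofReal (M / κ) := by
          rw [setLIntegral_const, Real.volume_Ioc]
          exact mul_le_of_le_one_right' (ENNReal.ofReal_le_one.2 (by linarith))

/-- The Dini integral of the dilation of `ω` by `κ⁻ⁿ` grows at most linearly in `n`. -/
lemma lintegral_dilate_le {κ : ℝ} (hκ : κ ∈ Ioo (0 : ℝ) 1) {ω : ℝ → ℝ} {M : ℝ} (hM : 0 ≤ M)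
    (hωbd : ∀ t ∈ Ioc (0 : ℝ) 1, ω t ≤ M) (n : ℕ) :
    ∫⁻ t in Ioc (0 : ℝ) 1, ENNReal.ofReal (ω (min (t / κ ^ n) 1) / t) ≤
      (∫⁻ t in Ioc (0 : ℝ) 1, ENNReal.ofReal (ω t / t)) + n * ENNReal.ofReal (M / κ) := by
  induction n with
  | zero =>
    refine le_of_eq ?_
    simp only [Nat.cast_zero, zero_mul, add_zero]
    refine setLIntegral_congr_fun measurableSet_Ioc fun t ht => ?_
    simp [min_eq_left ht.2]
  | succ n ih =>
    refine (lintegral_dilate_succ_le hκ hM hωbd n).trans ((add_le_add_left ih _).trans ?_)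
    push_cast
    rw [add_mul, one_mul, add_assoc]

/-- If `ω : (0,1] → [0,∞)` is bounded and satisfies the Dini condition
`∫₀¹ ω(t)/t dt < ∞`, then so does `ω̃`. -/
theorem tildeOmega_dini
    (κ : ℝ) (hκ : κ ∈ Set.Ioo (0:ℝ) (1/2)) (ω : ℝ → ℝ) (hωmeas : Measurable ω)
    (hωnn : ∀ t ∈ Set.Ioc (0:ℝ) 1, 0 ≤ ω t)
    (M : ℝ) (hωbd : ∀ t ∈ Set.Ioc (0:ℝ) 1, ω t ≤ M)
    (hdini : ∫⁻ t in Set.Ioc (0:ℝ) 1, ENNReal.ofReal (ω t / t) < ⊤) :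
    ∫⁻ t in Set.Ioc (0:ℝ) 1, ENNReal.ofReal (tildeOmega κ ω t / t) < ⊤ := by
  have hκ1 : κ ∈ Ioo (0 : ℝ) 1 := ⟨hκ.1, by linarith [hκ.2]⟩
  have h0 : 0 < κ := hκ.1
  have hM : 0 ≤ M := (hωnn 1 (by simp)).trans (hωbd 1 (by simp))
  have hpt : ∀ t ∈ Ioc (0 : ℝ) 1, ENNReal.ofReal (tildeOmega κ ω t / t) =
      ∑' i : ℕ, ENNReal.ofReal ((1 / 2) ^ (i + 1)) *
        ENNReal.ofReal (ω (min (t / κ ^ (i + 1)) 1) / t) := by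
    intro t ht
    have ht0 : 0 < t := ht.1
    have hmem (i : ℕ) : min (t / κ ^ (i + 1)) 1 ∈ Ioc (0 : ℝ) 1 :=
      ⟨lt_min (by positivity) one_pos, min_le_right _ _⟩
    have hnn (i : ℕ) : 0 ≤ (1 / 2 : ℝ) ^ (i + 1) * ω (min (t / κ ^ (i + 1)) 1) :=
      mul_nonneg (by positivity) (hωnn _ (hmem i))
    have hgeom : Summable fun i : ℕ => (1 / 2 : ℝ) ^ (i + 1) * M :=
      ((summable_nat_add_iff 1).2 summable_geometric_two).mul_right M
    have hsum : Summable fun i : ℕ => (1 / 2 : ℝ) ^ (i + 1) * ω (min (t / κ ^ (i + 1)) 1) :=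
      hgeom.of_nonneg_of_le hnn fun i =>
        mul_le_mul_of_nonneg_left (hωbd _ (hmem i)) (by positivity)
    rw [tildeOmega, ← tsum_div_const,
      ENNReal.ofReal_tsum_of_nonneg (fun i => div_nonneg (hnn i) ht0.le) (hsum.div_const t)]
    refine tsum_congr fun i => ?_
    rw [← ENNReal.ofReal_mul (by positivity), mul_div_assoc]
  rw [setLIntegral_congr_fun measurableSet_Ioc hpt, lintegral_tsum fun i => by fun_prop]
  set D := ∫⁻ t in Ioc (0 : ℝ) 1, ENNReal.ofReal (ω t / t)
  have hsum : Summable fun i : ℕ =>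
      (1 / 2 : ℝ) ^ (i + 1) * (D.toReal + (i + 1 : ℕ) * (M / κ)) := by
    refine (summable_nat_add_iff (f := fun i : ℕ =>
      (1 / 2 : ℝ) ^ i * (D.toReal + i * (M / κ))) 1).2 ?_
    have h1 := summable_geometric_two.mul_right D.toReal
    have h2 := (summable_pow_mul_geometric_of_norm_lt_one 1
      (r := (1 / 2 : ℝ)) (by norm_num)).mul_right (M / κ)
    exact (h1.add h2).congr fun i => by ring
  refine lt_of_le_of_lt (ENNReal.tsum_le_tsum fun i => ?_) hsum.tsum_ofReal_lt_top
  rw [lintegral_const_mul _ (by fun_prop), ENNReal.ofReal_mul (by positivity)]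
  gcongr
  refine (lintegral_dilate_le hκ1 hM hωbd (i + 1)).trans (le_of_eq ?_)
  rw [ENNReal.ofReal_add (by positivity) (by positivity), ENNReal.ofReal_toReal hdini.ne,
    ENNReal.ofReal_mul (by positivity), ENNReal.ofReal_natCast]
end

section
/- Let d ≥ 1 and γ > 0. Define f : ℝ^d → ℝ by f(x) = (ln(1/|x|))^{−γ} for 0 < |x| < 1/8, f(0) = 0, and f(x) = (ln 8)^{−γ} for |x| ≥ 1/8. Then: (i) there exist C > 0 and r₀ ∈ (0,1) such that ω_f(r) ≤ C (ln(1/r))^{−γ−1} for all 0 < r < r₀; in particular ∫₀¹ ω_f(r)/r dr < ∞, i.e., f has Dini mean oscillation; (ii) for every 0 < r < 1/8 one has sup{ |f(x) − f(y)| : x, y ∈ B₁, |x−y| ≤ r } ≥ (ln(1/r))^{−γ}, so if γ ≤ 1 then the modulus of continuity ρ_f(r) := sup{ |f(x)−f(y)| : x, y ∈ B₁, |x−y| ≤ r } satisfies ∫₀^{1/8} ρ_f(r)/r dr = ∞, i.e., f is not Dini continuous. -/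
open MeasureTheory Metric Set

/-- Mean oscillation function `ω_h(r) = sup_{x ∈ B₃} ⨍_{B(x,r)} |h − h̄_{B(x,r)}|`. -/
noncomputable def meanOsc {d : ℕ}
    (h : EuclideanSpace ℝ (Fin d) → ℝ) (r : ℝ) : ℝ :=
  ⨆ x ∈ ball (0 : EuclideanSpace ℝ (Fin d)) 3,
    ⨍ y in ball x r, |h y - ⨍ z in ball x r, h z|

/-- The (uniform) modulus of continuity of `h` on `B₁`. -/
noncomputable def modCont {d : ℕ}
    (h : EuclideanSpace ℝ (Fin d) → ℝ) (r : ℝ) : ℝ :=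
  sSup {v : ℝ | ∃ x ∈ ball (0 : EuclideanSpace ℝ (Fin d)) 1,
    ∃ y ∈ ball (0 : EuclideanSpace ℝ (Fin d)) 1, dist x y ≤ r ∧ v = |h x - h y|}

/-- The function `f(x) = (ln(1/|x|))^{-γ}` near the origin. -/
noncomputable def logPowFun (d : ℕ) (γ : ℝ) (x : EuclideanSpace ℝ (Fin d)) : ℝ :=
  if ‖x‖ = 0 then 0
  else if ‖x‖ < 1/8 then (Real.log (1/‖x‖)) ^ (-γ)
  else (Real.log 8) ^ (-γ)

/-- Tangent-line bound for the convex function `u ↦ u ^ (-γ)`. -/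
lemma rpow_neg_sub_rpow_neg_le {γ a b : ℝ} (hγ : 0 ≤ γ) (ha : 0 < a) (hb : 0 < b) :
    a ^ (-γ) - b ^ (-γ) ≤ γ * a ^ (-γ - 1) * (b - a) := by
  have hba : 0 < b / a := div_pos hb ha
  have h1 : 1 - γ * (b / a - 1) ≤ (b / a) ^ (-γ) := by
    rw [Real.rpow_def_of_pos hba]
    have h2 := Real.add_one_le_exp (Real.log (b / a) * -γ)
    nlinarith [Real.log_le_sub_one_of_pos hba]
  have h3 : b ^ (-γ) = a ^ (-γ) * (b / a) ^ (-γ) := by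
    rw [← Real.mul_rpow ha.le hba.le]
    congr 1
    field_simp
  have h4 : a ^ (-γ - 1) = a ^ (-γ) / a := by
    rw [Real.rpow_sub ha, Real.rpow_one]
  have h5 : 0 < a ^ (-γ) := Real.rpow_pos_of_pos ha _
  have h6 : γ * (a ^ (-γ) / a) * (b - a) = a ^ (-γ) * (γ * (b / a - 1)) := by
    field_simp
  rw [h3, h4, h6]
  nlinarith

lemma one_lt_log_eight : 1 < Real.log 8 := by
  rw [Real.lt_log_iff_exp_lt (by norm_num)]
  linarith [Real.exp_one_lt_d9]

lemma log_eight_le_log_inv {t : ℝ} (ht : 0 < t) (ht8 : t ≤ 1 / 8) :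
    Real.log 8 ≤ Real.log (1 / t) := by
  apply Real.log_le_log (by norm_num)
  rw [le_div_iff₀ ht]
  linarith

lemma rpow_neg_le_of_le_mul {a b c p : ℝ} (hp : 0 ≤ p) (ha : 0 < a) (hb : 0 < b) (hc : 0 < c)
    (h : b ≤ c * a) : a ^ (-p) ≤ c ^ p * b ^ (-p) := by
  have h1 : b ^ p ≤ c ^ p * a ^ p := by
    rw [← Real.mul_rpow hc.le ha.le]
    exact Real.rpow_le_rpow hb.le h hp
  have hap := Real.rpow_pos_of_pos ha p
  have hbp := Real.rpow_pos_of_pos hb p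
  rw [Real.rpow_neg ha.le, Real.rpow_neg hb.le, ← div_eq_mul_inv, ← one_div,
    div_le_div_iff₀ hap hbp]
  linarith

/-- The function `t ↦ (log (1/t)) ^ (-γ - 1) / t` is almost decreasing on `(0, 1/8]`. -/
lemma log_rpow_div_le {γ r b : ℝ} (hγ : 0 ≤ γ) (hr : 0 < r) (hrb : r ≤ b) (hb : b ≤ 1 / 8) :
    r / b * Real.log (1 / b) ^ (-γ - 1) ≤
      (γ + 2) ^ (γ + 1) * Real.log (1 / r) ^ (-γ - 1) := by
  have hb0 : 0 < b := hr.trans_le hrb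
  have hp : 0 < γ + 1 := by linarith
  have hs : 1 ≤ b / r := (one_le_div hr).2 hrb
  have hs0 : 0 < b / r := by linarith
  have hlb := log_eight_le_log_inv hb0 hb
  have hlr := log_eight_le_log_inv hr (hrb.trans hb)
  have h8 := one_lt_log_eight
  set S := (b / r) ^ (γ + 1)⁻¹ with hS
  have hS1 : 1 ≤ S := Real.one_le_rpow hs (by positivity)
  have hlog : Real.log (b / r) ≤ (γ + 1) * S := by
    have := Real.log_le_rpow_div hs0.le (inv_pos.2 hp)
    rwa [div_inv_eq_mul, mul_comm] at this
  have hsum : Real.log (1 / r) = Real.log (1 / b) + Real.log (b / r) := by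
    rw [← Real.log_mul (by positivity) (by positivity)]
    congr 1
    field_simp
  have hlog0 : 0 ≤ Real.log (b / r) := Real.log_nonneg hs
  have hle : Real.log (1 / r) ≤ ((γ + 2) * S) * Real.log (1 / b) := by
    rw [hsum]
    have : 1 + Real.log (b / r) ≤ (γ + 2) * S := by nlinarith
    nlinarith
  have h1 := rpow_neg_le_of_le_mul hp.le (by linarith : 0 < Real.log (1 / b))
    (by linarith : 0 < Real.log (1 / r)) (by positivity) hle
  have h2 : S ^ (γ + 1) = b / r := by
    rw [hS, ← Real.rpow_mul hs0.le, inv_mul_cancel₀ hp.ne', Real.rpow_one]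
  rw [Real.mul_rpow (by linarith) (by linarith), h2, neg_add'] at h1
  calc _ ≤ r / b * ((γ + 2) ^ (γ + 1) * (b / r) * Real.log (1 / r) ^ (-γ - 1)) := by
        gcongr
    _ = _ := by field_simp

/-- On scales larger than `r`, an increment of length at most `r` changes `(log (1/t)) ^ (-γ)`
by at most a multiple of `(log (1/r)) ^ (-γ - 1)`. -/
lemma log_rpow_sub_le {γ r a b : ℝ} (hγ : 0 ≤ γ) (hr : 0 < r) (hra : r ≤ a) (hab : a ≤ b)
    (hb : b ≤ 1 / 8) (hbr : b ≤ a + r) :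
    Real.log (1 / b) ^ (-γ) - Real.log (1 / a) ^ (-γ) ≤
      2 * γ * (γ + 2) ^ (γ + 1) * Real.log (1 / r) ^ (-γ - 1) := by
  have ha0 : 0 < a := hr.trans_le hra
  have hb0 : 0 < b := ha0.trans_le hab
  have hlb := log_eight_le_log_inv hb0 hb
  have hla := log_eight_le_log_inv ha0 (hab.trans hb)
  have h8 := one_lt_log_eight
  have h1 := rpow_neg_sub_rpow_neg_le hγ (by linarith : 0 < Real.log (1 / b))
    (by linarith : 0 < Real.log (1 / a))
  have h2 : Real.log (1 / a) - Real.log (1 / b) ≤ 2 * (r / b) := by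
    rw [← Real.log_div (by positivity) (by positivity)]
    have h3 : 1 / a / (1 / b) = b / a := by field_simp
    rw [h3]
    have h4 := Real.log_le_sub_one_of_pos (div_pos hb0 ha0)
    have h5 : b / a - 1 ≤ 2 * (r / b) := by
      have : b / a - 1 = (b - a) / a := by field_simp
      rw [this, mul_div_assoc', div_le_div_iff₀ ha0 hb0]
      nlinarith
    linarith
  have h6 : 0 < Real.log (1 / b) ^ (-γ - 1) := Real.rpow_pos_of_pos (by linarith) _
  calc _ ≤ _ := h1
    _ ≤ γ * Real.log (1 / b) ^ (-γ - 1) * (2 * (r / b)) := by gcongr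
    _ = 2 * γ * (r / b * Real.log (1 / b) ^ (-γ - 1)) := by ring
    _ ≤ 2 * γ * ((γ + 2) ^ (γ + 1) * Real.log (1 / r) ^ (-γ - 1)) := by
        exact mul_le_mul_of_nonneg_left (log_rpow_div_le hγ hr (hra.trans hab) hb)
          (by positivity)
    _ = _ := by ring

section logPowFun

variable {d : ℕ} {γ : ℝ}

lemma logPowFun_zero : logPowFun d γ 0 = 0 := by simp [logPowFun]

lemma logPowFun_of_ne_zero {x : EuclideanSpace ℝ (Fin d)} (hx : x ≠ 0) :
    logPowFun d γ x = Real.log (1 / min ‖x‖ (1 / 8)) ^ (-γ) := by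
  rw [logPowFun, if_neg (norm_ne_zero_iff.2 hx)]
  split_ifs with h
  · rw [min_eq_left h.le]
  · rw [min_eq_right (not_lt.1 h)]
    norm_num

lemma logPowFun_mem_Icc (hγ : 0 < γ) (x : EuclideanSpace ℝ (Fin d)) :
    logPowFun d γ x ∈ Icc (0 : ℝ) 1 := by
  by_cases hx : x = 0
  · simp [hx, logPowFun_zero]
  · rw [logPowFun_of_ne_zero hx]
    have h1 : 0 < min ‖x‖ (1 / 8) := lt_min (norm_pos_iff.2 hx) (by norm_num)
    have h2 := log_eight_le_log_inv h1 (min_le_right _ _)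
    have h3 := one_lt_log_eight
    exact ⟨Real.rpow_nonneg (by linarith) _,
      Real.rpow_le_one_of_one_le_of_nonpos (by linarith) (by linarith)⟩

lemma measurable_logPowFun : Measurable (logPowFun d γ) := by
  unfold logPowFun
  refine Measurable.ite (measurableSet_eq_fun measurable_norm measurable_const) measurable_const
    (Measurable.ite (measurableSet_lt measurable_norm measurable_const) ?_ measurable_const)
  fun_prop

lemma integrable_logPowFun (hγ : 0 < γ) (μ : Measure (EuclideanSpace ℝ (Fin d)))
    [IsFiniteMeasure μ] : Integrable (logPowFun d γ) μ := by
  refine Integrable.of_bound measurable_logPowFun.aestronglyMeasurable 1 (ae_of_all _ fun x => ?_)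
  have := logPowFun_mem_Icc hγ x
  rw [Real.norm_eq_abs, abs_of_nonneg this.1]
  exact this.2

/-- Away from the origin relative to its own scale, `logPowFun` oscillates little. -/
lemma abs_logPowFun_sub_le (hγ : 0 ≤ γ) {r : ℝ} (hr : 0 < r) (hr8 : r ≤ 1 / 8)
    {x y : EuclideanSpace ℝ (Fin d)} (hx : r ≤ ‖x‖) (hy : r ≤ ‖y‖) (hxy : dist y x ≤ r) :
    |logPowFun d γ y - logPowFun d γ x| ≤
      2 * γ * (γ + 2) ^ (γ + 1) * Real.log (1 / r) ^ (-γ - 1) := by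
  have key : ∀ {x y : EuclideanSpace ℝ (Fin d)}, r ≤ ‖x‖ → r ≤ ‖y‖ → dist y x ≤ r →
      logPowFun d γ y - logPowFun d γ x ≤
        2 * γ * (γ + 2) ^ (γ + 1) * Real.log (1 / r) ^ (-γ - 1) := by
    intro x y hx hy hxy
    have hx0 : x ≠ 0 := norm_pos_iff.1 (hr.trans_le hx)
    have hy0 : y ≠ 0 := norm_pos_iff.1 (hr.trans_le hy)
    rw [logPowFun_of_ne_zero hx0, logPowFun_of_ne_zero hy0]
    have h8 := one_lt_log_eight
    rcases le_total (min ‖x‖ (1 / 8)) (min ‖y‖ (1 / 8)) with h | h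
    · refine log_rpow_sub_le hγ hr (le_min hx hr8) h (min_le_right _ _) ?_
      have h1 := abs_inf_sub_inf_le_abs ‖y‖ ‖x‖ (1 / 8)
      have h2 := abs_norm_sub_norm_le y x
      rw [← dist_eq_norm] at h2
      have h3 := le_abs_self (‖y‖ ⊓ 1 / 8 - ‖x‖ ⊓ 1 / 8)
      linarith
    · have hm : 0 < min ‖y‖ (1 / 8) := hr.trans_le (le_min hy hr8)
      have hm8 := log_eight_le_log_inv (hm.trans_le h) (min_le_right _ _)
      have h1 : Real.log (1 / min ‖x‖ (1 / 8)) ≤ Real.log (1 / min ‖y‖ (1 / 8)) :=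
        Real.log_le_log (one_div_pos.2 (hm.trans_le h)) (one_div_le_one_div_of_le hm h)
      have h2 := Real.rpow_le_rpow_of_nonpos (by linarith) h1 (neg_nonpos.2 hγ)
      have h3 := log_eight_le_log_inv hr hr8
      have h4 : 0 ≤ Real.log (1 / r) ^ (-γ - 1) := Real.rpow_nonneg (by linarith) _
      have h5 : 0 ≤ 2 * γ * (γ + 2) ^ (γ + 1) * Real.log (1 / r) ^ (-γ - 1) := by positivity
      linarith
  rw [abs_le']
  refine ⟨key hx hy hxy, ?_⟩
  rw [neg_sub]
  exact key hy hx (by rwa [dist_comm])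

/-- Near the origin `logPowFun` differs from a constant by at most a logarithm. -/
lemma abs_logPowFun_sub_le_log (hγ : 0 ≤ γ) {R : ℝ} (hR8 : R ≤ 1 / 8)
    {y : EuclideanSpace ℝ (Fin d)} (hy : y ≠ 0) (hyR : ‖y‖ ≤ R) :
    |logPowFun d γ y - Real.log (1 / R) ^ (-γ)| ≤
      γ * Real.log (1 / R) ^ (-γ - 1) * Real.log (R / ‖y‖) := by
  have hy0 : 0 < ‖y‖ := norm_pos_iff.2 hy
  have hR : 0 < R := hy0.trans_le hyR
  have h8 := one_lt_log_eight
  have hlR := log_eight_le_log_inv hR hR8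
  have hly := log_eight_le_log_inv hy0 (hyR.trans hR8)
  rw [logPowFun_of_ne_zero hy, min_eq_left (hyR.trans hR8), abs_sub_comm, abs_of_nonneg]
  · have h1 := rpow_neg_sub_rpow_neg_le hγ (by linarith : 0 < Real.log (1 / R))
      (by linarith : 0 < Real.log (1 / ‖y‖))
    have h2 : Real.log (R / ‖y‖) = Real.log (1 / ‖y‖) - Real.log (1 / R) := by
      rw [← Real.log_div (by positivity) (by positivity)]
      congr 1
      field_simp
    rwa [h2]
  · rw [sub_nonneg]
    exact Real.rpow_le_rpow_of_nonpos (by linarith)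
      (Real.log_le_log (by positivity) (one_div_le_one_div_of_le hy0 hyR)) (neg_nonpos.2 hγ)

end logPowFun

/-- The mean oscillation is at most twice the mean distance to any constant. -/
lemma integral_abs_sub_integral_le {α : Type*} [MeasurableSpace α] {μ : Measure α}
    [IsProbabilityMeasure μ] {h : α → ℝ} (hh : Integrable h μ) (c : ℝ) :
    ∫ y, |h y - ∫ z, h z ∂μ| ∂μ ≤ 2 * ∫ y, |h y - c| ∂μ := by
  set m := ∫ z, h z ∂μ with hm
  have h1 : |m - c| ≤ ∫ y, |h y - c| ∂μ := by
    have : m - c = ∫ y, (h y - c) ∂μ := by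
      rw [integral_sub hh (integrable_const _)]
      simp [hm]
    rw [this]
    exact abs_integral_le_integral_abs
  have hi : ∀ a : ℝ, Integrable (fun y => |h y - a|) μ := fun a =>
    (hh.sub (integrable_const a)).abs
  calc ∫ y, |h y - m| ∂μ ≤ ∫ y, (|h y - c| + |m - c|) ∂μ := by
        refine integral_mono (hi m) ((hi c).add (integrable_const _)) fun y => ?_
        have := abs_sub_le (h y) c m
        rwa [abs_sub_comm c m] at this
    _ = (∫ y, |h y - c| ∂μ) + |m - c| := by
        rw [integral_add (hi c) (integrable_const _)]
        simp
    _ ≤ _ := by linarith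

lemma setAverage_abs_sub_setAverage_le {α : Type*} [MeasurableSpace α] {μ : Measure α}
    {s : Set α} (hs0 : μ s ≠ 0) (hs : μ s ≠ ⊤) {h : α → ℝ} (hh : IntegrableOn h s μ) (c : ℝ) :
    ⨍ y in s, |h y - ⨍ z in s, h z ∂μ| ∂μ ≤ 2 * ⨍ y in s, |h y - c| ∂μ := by
  have : IsFiniteMeasure (μ.restrict s) := ⟨by simpa using hs.lt_top⟩
  have : NeZero (μ.restrict s) := ⟨by simpa [Measure.restrict_eq_zero] using hs0⟩
  exact integral_abs_sub_integral_le (μ := ((μ.restrict s) univ)⁻¹ • μ.restrict s)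
    hh.to_average c

section logIntegral

variable {E : Type*} [NormedAddCommGroup E] [NormedSpace ℝ E] [FiniteDimensional ℝ E]
  [MeasurableSpace E] [BorelSpace E] (μ : Measure E) [μ.IsAddHaarMeasure]

lemma integrableOn_log_div_norm [Nontrivial E] {R : ℝ} (hR : 0 < R) :
    IntegrableOn (fun y : E => Real.log (R / ‖y‖)) (ball 0 R) μ := by
  refine (integrableOn_fun_norm_addHaar (F := ℝ) μ (f := fun t => Real.log (R / t))).2 ?_
  have h1 : IntegrableOn (fun t : ℝ => Real.log R - Real.log t) (Icc 0 R) := by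
    rw [integrableOn_Icc_iff_integrableOn_Ioc,
      ← intervalIntegrable_iff_integrableOn_Ioc_of_le hR.le]
    exact intervalIntegrable_const.sub intervalIntegral.intervalIntegrable_log'
  have h2 : IntegrableOn (fun t : ℝ => t ^ (Module.finrank ℝ E - 1) *
      (Real.log R - Real.log t)) (Icc 0 R) :=
    h1.continuousOn_mul (continuous_pow _).continuousOn isCompact_Icc
  refine (h2.mono_set Ioo_subset_Icc_self).congr_fun (fun t ht => ?_) measurableSet_Ioo
  simp only [smul_eq_mul]
  rw [Real.log_div hR.ne' ht.1.ne']

lemma setIntegral_log_div_norm {R : ℝ} (hR : 0 < R) :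
    ∫ y in ball (0 : E) R, Real.log (R / ‖y‖) ∂μ =
      R ^ Module.finrank ℝ E * ∫ y in ball (0 : E) 1, Real.log (1 / ‖y‖) ∂μ := by
  have h := Measure.setIntegral_comp_smul_of_pos μ (fun y : E => Real.log (R / ‖y‖))
    (ball (0 : E) 1) hR
  rw [smul_unitBall_of_pos hR] at h
  have h1 : ∀ y : E, Real.log (R / ‖R • y‖) = Real.log (1 / ‖y‖) := fun y => by
    rw [norm_smul, Real.norm_of_nonneg hR.le, div_mul_eq_div_div, div_self hR.ne']
  simp only [h1] at h
  rw [h, smul_eq_mul, mul_inv_cancel_left₀ (by positivity)]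

end logIntegral

section oscillation

variable {d : ℕ} {γ : ℝ}

lemma meanOsc_le {h : EuclideanSpace ℝ (Fin d) → ℝ} {r M : ℝ} (hM : 0 ≤ M)
    (H : ∀ x, ⨍ y in ball x r, |h y - ⨍ z in ball x r, h z| ≤ M) : meanOsc h r ≤ M :=
  Real.iSup_le (fun x => Real.iSup_le (fun _ => H x) hM) hM

lemma meanOsc_logPowFun_le_of_forall (hγ : 0 < γ) {r M : ℝ} (hr : 0 < r) (hM : 0 ≤ M)
    (H : ∀ x, ∃ c : ℝ, ⨍ y in ball x r, |logPowFun d γ y - c| ≤ M) :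
    meanOsc (logPowFun d γ) r ≤ 2 * M := by
  refine meanOsc_le (by positivity) fun x => ?_
  obtain ⟨c, hc⟩ := H x
  have : IsFiniteMeasure (volume.restrict (ball x r)) := ⟨by simp [measure_ball_lt_top]⟩
  have := setAverage_abs_sub_setAverage_le (measure_ball_pos volume x hr).ne'
    measure_ball_lt_top.ne (integrable_logPowFun hγ (volume.restrict (ball x r))) c
  linarith

lemma setAverage_abs_le_of_forall {r M : ℝ} (hr : 0 < r) {x : EuclideanSpace ℝ (Fin d)}
    {h : EuclideanSpace ℝ (Fin d) → ℝ} (H : ∀ y ∈ ball x r, |h y| ≤ M) :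
    ⨍ y in ball x r, |h y| ≤ M := by
  have hv : 0 < volume.real (ball x r) :=
    ENNReal.toReal_pos (measure_ball_pos volume x hr).ne' measure_ball_lt_top.ne
  rw [setAverage_eq, smul_eq_mul, inv_mul_le_iff₀ hv, mul_comm]
  refine (le_abs_self _).trans
    (norm_setIntegral_le_of_norm_le_const (E := ℝ) measure_ball_lt_top fun y hy => ?_)
  rw [Real.norm_eq_abs, abs_abs]
  exact H y hy

lemma meanOsc_logPowFun_le_two (hγ : 0 < γ) {r : ℝ} (hr : 0 < r) :
    meanOsc (logPowFun d γ) r ≤ 2 := by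
  have := meanOsc_logPowFun_le_of_forall (d := d) hγ hr zero_le_one fun x =>
    ⟨0, setAverage_abs_le_of_forall hr fun y _ => ?_⟩
  · simpa using this
  · have := logPowFun_mem_Icc hγ y
    rw [sub_zero, abs_of_nonneg this.1]
    exact this.2

lemma setAverage_abs_logPowFun_sub_le [NeZero d] (hγ : 0 < γ) {r : ℝ} (hr : 0 < r)
    (hr' : 3 * r ≤ 1 / 8) {x : EuclideanSpace ℝ (Fin d)} (hx : ‖x‖ < 2 * r) :
    ⨍ y in ball x r, |logPowFun d γ y - Real.log (1 / (3 * r)) ^ (-γ)| ≤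
      γ * Real.log (1 / (3 * r)) ^ (-γ - 1) *
        (3 ^ d * (∫ y in ball (0 : EuclideanSpace ℝ (Fin d)) 1, Real.log (1 / ‖y‖)) /
          volume.real (ball (0 : EuclideanSpace ℝ (Fin d)) 1)) := by
  have h3r : 0 < 3 * r := by linarith
  set L := Real.log (1 / (3 * r)) with hL
  have hv1 : 0 < volume.real (ball (0 : EuclideanSpace ℝ (Fin d)) 1) :=
    ENNReal.toReal_pos (measure_ball_pos volume _ one_pos).ne' measure_ball_lt_top.ne
  have hv : volume.real (ball x r) =
      r ^ d * volume.real (ball (0 : EuclideanSpace ℝ (Fin d)) 1) := by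
    rw [measureReal_def, Measure.addHaar_ball volume x hr.le, ENNReal.toReal_mul,
      ENNReal.toReal_ofReal (by positivity), finrank_euclideanSpace_fin, measureReal_def]
  have hsub : ball x r ⊆ ball 0 (3 * r) := by
    refine ball_subset_ball' ?_
    rw [dist_zero_right]
    linarith
  have : IsFiniteMeasure (volume.restrict (ball (0 : EuclideanSpace ℝ (Fin d)) (3 * r))) :=
    ⟨by simp [measure_ball_lt_top]⟩
  have hint : IntegrableOn (fun y => |logPowFun d γ y - L ^ (-γ)|)
      (ball (0 : EuclideanSpace ℝ (Fin d)) (3 * r)) :=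
    ((integrable_logPowFun hγ _).sub (integrable_const _)).abs
  have h1 : ∫ y in ball x r, |logPowFun d γ y - L ^ (-γ)| ≤
      γ * L ^ (-γ - 1) * ((3 * r) ^ d *
        ∫ y in ball (0 : EuclideanSpace ℝ (Fin d)) 1, Real.log (1 / ‖y‖)) := by
    calc _ ≤ ∫ y in ball 0 (3 * r), |logPowFun d γ y - L ^ (-γ)| :=
          setIntegral_mono_set hint (ae_of_all _ fun y => abs_nonneg _) hsub.eventuallyLE
      _ ≤ ∫ y in ball (0 : EuclideanSpace ℝ (Fin d)) (3 * r),
            γ * L ^ (-γ - 1) * Real.log (3 * r / ‖y‖) := by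
          refine setIntegral_mono_on_ae hint
            ((integrableOn_log_div_norm volume h3r).const_mul _) measurableSet_ball ?_
          filter_upwards [compl_mem_ae_iff.2 (measure_singleton
            (0 : EuclideanSpace ℝ (Fin d)))] with y hy hyb
          exact abs_logPowFun_sub_le_log hγ.le hr' hy (mem_ball_zero_iff.1 hyb).le
      _ = _ := by
          rw [integral_const_mul, setIntegral_log_div_norm volume h3r,
            finrank_euclideanSpace_fin]
  rw [setAverage_eq, smul_eq_mul, hv, inv_mul_le_iff₀ (by positivity)]
  refine h1.trans_eq ?_
  rw [mul_pow]
  field_simp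

lemma exists_meanOsc_logPowFun_le [NeZero d] (hγ : 0 < γ) :
    ∃ C : ℝ, 0 < C ∧ ∀ r : ℝ, 0 < r → r < 1 / 24 →
      meanOsc (logPowFun d γ) r ≤ C * Real.log (1 / r) ^ (-γ - 1) := by
  set K := 3 ^ d * (∫ y in ball (0 : EuclideanSpace ℝ (Fin d)) 1, Real.log (1 / ‖y‖)) /
    volume.real (ball (0 : EuclideanSpace ℝ (Fin d)) 1) with hK
  have hK0 : 0 ≤ K := by
    refine div_nonneg (mul_nonneg (by positivity)
      (setIntegral_nonneg measurableSet_ball fun y hy => ?_)) measureReal_nonneg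
    rw [one_div, Real.log_inv]
    exact neg_nonneg.2 (Real.log_nonpos (norm_nonneg _) (mem_ball_zero_iff.1 hy).le)
  set A := 2 * γ * (γ + 2) ^ (γ + 1) with hA
  have hA0 : 0 < A := by positivity
  set B := γ * 2 ^ (γ + 1) * K with hB
  have hB0 : 0 ≤ B := by positivity
  refine ⟨2 * (A + B), by positivity, fun r hr hr' => ?_⟩
  have h8 := one_lt_log_eight
  have hlr := log_eight_le_log_inv hr (by linarith)
  have hl3 := log_eight_le_log_inv (by linarith : 0 < 3 * r) (by linarith)
  have hP : 0 < Real.log (1 / r) ^ (-γ - 1) := Real.rpow_pos_of_pos (by linarith) _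
  rw [mul_assoc]
  refine meanOsc_logPowFun_le_of_forall hγ hr (by positivity) fun x => ?_
  rw [add_mul]
  rcases lt_or_ge ‖x‖ (2 * r) with hx | hx
  · refine ⟨_, (setAverage_abs_logPowFun_sub_le hγ hr (by linarith) hx).trans ?_⟩
    have h1 : Real.log (1 / r) ≤ 2 * Real.log (1 / (3 * r)) := by
      have h2 : Real.log (1 / r) = Real.log 3 + Real.log (1 / (3 * r)) := by
        rw [← Real.log_mul (by norm_num) (by positivity)]
        congr 1
        field_simp
      have h3 : Real.log 3 ≤ Real.log 8 := Real.log_le_log (by norm_num) (by norm_num)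
      linarith
    have h4 := rpow_neg_le_of_le_mul (by linarith : 0 ≤ γ + 1)
      (by linarith : 0 < Real.log (1 / (3 * r))) (by linarith : 0 < Real.log (1 / r))
      two_pos h1
    rw [neg_add'] at h4
    calc γ * Real.log (1 / (3 * r)) ^ (-γ - 1) * K
        ≤ γ * (2 ^ (γ + 1) * Real.log (1 / r) ^ (-γ - 1)) * K := by gcongr
      _ = B * Real.log (1 / r) ^ (-γ - 1) := by rw [hB]; ring
      _ ≤ _ := le_add_of_nonneg_left (by positivity)
  · refine ⟨logPowFun d γ x, (setAverage_abs_le_of_forall hr fun y hy => ?_).trans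
      (le_add_of_nonneg_right (by positivity))⟩
    have hyx : dist y x < r := hy
    refine abs_logPowFun_sub_le hγ.le hr (by linarith) (by linarith) ?_ hyx.le
    have := norm_sub_norm_le x y
    rw [← dist_eq_norm, dist_comm] at this
    linarith

end oscillation

/-- `(log (1/r)) ^ (-γ - 1) / r` is integrable near `0`. -/
lemma integrableOn_log_rpow_div {γ b : ℝ} (hγ : 0 < γ) (hb : b < 1) :
    IntegrableOn (fun r : ℝ => Real.log (1 / r) ^ (-γ - 1) / r) (Ioc 0 b) := by
  have hpos : ∀ r : ℝ, 0 < r → r ≤ b → 0 < Real.log (1 / r) := fun r hr hrb =>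
    Real.log_pos ((one_lt_div hr).2 (by linarith))
  refine intervalIntegral.integrableOn_deriv_of_nonneg
    (g := fun r => γ⁻¹ * Real.log (1 / r) ^ (-γ)) ?_ ?_ ?_
  · intro r hr
    rcases hr.1.eq_or_lt with rfl | hr0
    · refine ContinuousAt.continuousWithinAt ?_
      rw [continuousAt_iff_punctured_nhds]
      have h1 : Filter.Tendsto (fun r : ℝ => Real.log (1 / r)) (nhdsWithin 0 {0}ᶜ)
          Filter.atTop := by
        simp only [one_div, Real.log_inv]
        exact Filter.tendsto_neg_atBot_atTop.comp Real.tendsto_log_nhdsNE_zero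
      have h2 := ((tendsto_rpow_neg_atTop hγ).comp h1).const_mul γ⁻¹
      simpa [Real.zero_rpow (neg_ne_zero.2 hγ.ne')] using h2
    · refine ContinuousAt.continuousWithinAt (ContinuousAt.const_mul ?_ _)
      have h1 : ContinuousAt (fun r : ℝ => Real.log (1 / r)) r :=
        (continuousAt_const.div continuousAt_id hr0.ne').log (by simpa using hr0.ne')
      exact h1.rpow_const (Or.inl (hpos r hr0 hr.2).ne')
  · intro r hr
    have h1 : HasDerivAt (fun r : ℝ => Real.log (1 / r)) (-r⁻¹) r := by
      simp only [one_div, Real.log_inv]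
      exact (Real.hasDerivAt_log hr.1.ne').neg
    have h2 := (h1.rpow_const (p := -γ) (Or.inl (hpos r hr.1 hr.2.le).ne')).const_mul γ⁻¹
    refine h2.congr_deriv ?_
    field_simp
  · intro r hr
    exact div_nonneg (Real.rpow_nonneg (hpos r hr.1 hr.2.le).le _) hr.1.le

lemma lintegral_meanOsc_logPowFun_lt_top {d : ℕ} [NeZero d] {γ : ℝ} (hγ : 0 < γ) :
    ∫⁻ r in Ioc (0 : ℝ) 1, ENNReal.ofReal (meanOsc (logPowFun d γ) r / r) < ⊤ := by
  obtain ⟨C, hC, H⟩ := exists_meanOsc_logPowFun_le (d := d) hγ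
  rw [← Ioc_union_Ioc_eq_Ioc (by norm_num : (0 : ℝ) ≤ 1 / 25) (by norm_num : (1 / 25 : ℝ) ≤ 1)]
  refine (lintegral_union_le _ _ _).trans_lt (ENNReal.add_lt_top.2 ⟨?_, ?_⟩)
  · refine (setLIntegral_mono' measurableSet_Ioc fun r hr => ?_).trans_lt
      ((integrableOn_log_rpow_div (b := 1 / 25) hγ (by norm_num)).const_mul C).lintegral_lt_top
    refine ENNReal.ofReal_le_ofReal ?_
    rw [mul_div_assoc']
    exact div_le_div_of_nonneg_right (H r hr.1 (by linarith [hr.2])) hr.1.le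
  · refine (setLIntegral_mono' (g := fun _ => ENNReal.ofReal 50) measurableSet_Ioc
      fun r hr => ENNReal.ofReal_le_ofReal ?_).trans_lt ?_
    · have hr0 : 0 < r := lt_trans (by norm_num) hr.1
      rw [div_le_iff₀ hr0]
      linarith [hr.1, meanOsc_logPowFun_le_two (d := d) hγ hr0]
    · rw [setLIntegral_const]
      exact ENNReal.mul_lt_top ENNReal.ofReal_lt_top measure_Ioc_lt_top

lemma log_rpow_le_modCont_logPowFun {d : ℕ} [NeZero d] {γ r : ℝ} (hγ : 0 < γ) (hr : 0 < r)
    (hr8 : r < 1 / 8) : Real.log (1 / r) ^ (-γ) ≤ modCont (logPowFun d γ) r := by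
  refine le_csSup ⟨1, ?_⟩ ⟨0, by simp, EuclideanSpace.single 0 r, ?_, ?_, ?_⟩
  · rintro v ⟨x, -, y, -, -, rfl⟩
    have hx := logPowFun_mem_Icc hγ x
    have hy := logPowFun_mem_Icc hγ y
    rw [abs_le]
    constructor <;> linarith [hx.1, hx.2, hy.1, hy.2]
  · rw [mem_ball_zero_iff, PiLp.norm_single, Real.norm_of_nonneg hr.le]
    linarith
  · rw [dist_zero_left, PiLp.norm_single, Real.norm_of_nonneg hr.le]
  · have hn : ‖(EuclideanSpace.single 0 r : EuclideanSpace ℝ (Fin d))‖ = r := by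
      rw [PiLp.norm_single, Real.norm_of_nonneg hr.le]
    have h0 : (EuclideanSpace.single 0 r : EuclideanSpace ℝ (Fin d)) ≠ 0 := by
      rw [← norm_pos_iff, hn]
      exact hr
    have h8 := one_lt_log_eight
    have hl := log_eight_le_log_inv hr hr8.le
    rw [logPowFun_zero, logPowFun_of_ne_zero h0, hn, min_eq_left hr8.le, zero_sub, abs_neg,
      abs_of_nonneg (Real.rpow_nonneg (by linarith) _)]

/-- `1 / (r log (1/r))` is not integrable near `0`. -/
lemma not_integrableOn_inv_log_div :
    ¬ IntegrableOn (fun r : ℝ => (Real.log (1 / r))⁻¹ / r) (Ioo 0 (1 / 8)) := by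
  have hmem : Ioo (0 : ℝ) (1 / 8) ∈ nhdsWithin (0 : ℝ) (Ioi 0) :=
    Ioo_mem_nhdsGT (by norm_num)
  have hd : ∀ r ∈ Ioo (0 : ℝ) (1 / 8), HasDerivAt (fun r : ℝ => Real.log (Real.log (1 / r)))
      (-((Real.log (1 / r))⁻¹ / r)) r := by
    intro r hr
    have h8 := one_lt_log_eight
    have hl := log_eight_le_log_inv hr.1 hr.2.le
    have h1 : HasDerivAt (fun r : ℝ => Real.log (1 / r)) (-r⁻¹) r := by
      simp only [one_div, Real.log_inv]
      exact (Real.hasDerivAt_log hr.1.ne').neg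
    refine (h1.log (by linarith)).congr_deriv ?_
    field_simp
  refine not_integrableOn_of_tendsto_norm_atTop_of_deriv_isBigO_filter
    (f := fun r : ℝ => Real.log (Real.log (1 / r))) (nhdsWithin (0 : ℝ) (Ioi 0)) hmem ?_ ?_ ?_
  · filter_upwards [hmem] with r hr using (hd r hr).differentiableAt
  · refine tendsto_norm_atTop_atTop.comp (Real.tendsto_log_atTop.comp ?_)
    simp only [one_div, Real.log_inv]
    exact Filter.tendsto_neg_atBot_atTop.comp Real.tendsto_log_nhdsGT_zero
  · refine Asymptotics.IsBigO.of_bound 1 ?_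
    filter_upwards [hmem] with r hr
    rw [(hd r hr).deriv, norm_neg, one_mul]

lemma lintegral_modCont_logPowFun_eq_top {d : ℕ} [NeZero d] {γ : ℝ} (hγ : 0 < γ) (hγ1 : γ ≤ 1) :
    ∫⁻ r in Ioc (0 : ℝ) (1 / 8), ENNReal.ofReal (modCont (logPowFun d γ) r / r) = ⊤ := by
  by_contra hne
  refine not_integrableOn_inv_log_div ⟨?_, ?_⟩
  · exact Measurable.aestronglyMeasurable (by fun_prop)
  · have h8 := one_lt_log_eight
    rw [hasFiniteIntegral_iff_ofReal]
    · refine lt_of_le_of_lt ?_ (lt_top_iff_ne_top.2 hne)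
      refine (setLIntegral_mono' measurableSet_Ioo fun r hr => ?_).trans
        (lintegral_mono_set Ioo_subset_Ioc_self)
      refine ENNReal.ofReal_le_ofReal (div_le_div_of_nonneg_right ?_ hr.1.le)
      refine le_trans ?_ (log_rpow_le_modCont_logPowFun hγ hr.1 hr.2)
      have hl := log_eight_le_log_inv hr.1 hr.2.le
      rw [← Real.rpow_neg_one]
      exact Real.rpow_le_rpow_of_exponent_le (by linarith) (by linarith)
    · filter_upwards [ae_restrict_mem measurableSet_Ioo] with r hr
      have hl := log_eight_le_log_inv hr.1 hr.2.le
      exact div_nonneg (inv_nonneg.2 (by linarith)) hr.1.le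

/-- The function `f(x) = (ln(1/|x|))^{-γ}` has Dini mean oscillation (indeed
`ω_f(r) ≲ (ln(1/r))^{-γ-1}`), but for `γ ≤ 1` it is not Dini continuous, since its modulus of
continuity on `B₁` is at least `(ln(1/r))^{-γ}`. -/
theorem logPowFun_dini_mean_osc_not_dini_continuous
    (d : ℕ) (hd : 1 ≤ d) (γ : ℝ) (hγ : 0 < γ) :
    -- (i) Dini mean oscillation, with the quantitative bound ω_f(r) ≤ C (ln(1/r))^{-γ-1}
    ((∃ C : ℝ, 0 < C ∧ ∃ r₀ ∈ Set.Ioo (0:ℝ) 1, ∀ r : ℝ, 0 < r → r < r₀ →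
        meanOsc (logPowFun d γ) r ≤ C * (Real.log (1/r)) ^ (-γ - 1))
      ∧ ∫⁻ r in Set.Ioc (0:ℝ) 1, ENNReal.ofReal (meanOsc (logPowFun d γ) r / r) < ⊤)
    ∧
    -- (ii) the modulus of continuity is at least (ln(1/r))^{-γ}; not Dini continuous if γ ≤ 1
    ((∀ r : ℝ, 0 < r → r < 1/8 →
        (Real.log (1/r)) ^ (-γ) ≤ modCont (logPowFun d γ) r)
      ∧ (γ ≤ 1 →
          ∫⁻ r in Set.Ioc (0:ℝ) (1/8), ENNReal.ofReal (modCont (logPowFun d γ) r / r) = ⊤)) := by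
  have : NeZero d := ⟨by omega⟩
  obtain ⟨C, hC, H⟩ := exists_meanOsc_logPowFun_le (d := d) hγ
  exact ⟨⟨⟨C, hC, 1 / 24, by norm_num, H⟩, lintegral_meanOsc_logPowFun_lt_top hγ⟩,
    fun r hr hr8 => log_rpow_le_modCont_logPowFun hγ hr hr8,
    fun hγ1 => lintegral_modCont_logPowFun_eq_top hγ hγ1⟩
end
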